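/- Let X be a compact metric space, let σ : X → X be a minimal homeomorphism, let Y ⊆ X be a nonempty clopen subset, and let n(0) < n(1) < ... < n(l) be the distinct values taken by the first return time λ_Y on Y. Set Y_k = {x ∈ Y : λ_Y(x) = n(k)}. Then the sets σ^j(Y_k), for 0 ≤ k ≤ l and 1 ≤ j ≤ n(k), are pairwise disjoint and their union is X. -/

import Mathlib

/-- `firstReturnTimeIs σ Y x n` says that `n ≥ 1` is the smallest positive integer
with `σ^n x ∈ Y`, i.e. the first return time of `x` to `Y` equals `n`. -/
def firstReturnTimeIs {X : Type*} (σ : X → X) (Y : Set X) (x : X) (n : ℕ) : Prop :=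
  1 ≤ n ∧ σ^[n] x ∈ Y ∧ ∀ m : ℕ, 1 ≤ m → m < n → σ^[m] x ∉ Y

/-- A nonempty closed forward-invariant set of a minimal homeomorphism of a compact space
is the whole space. -/
theorem eq_univ_of_mapsTo_of_minimal {X : Type*} [TopologicalSpace X] [T2Space X]
    [CompactSpace X] (σ : X ≃ₜ X)
    (hmin : ∀ Z : Set X, IsClosed Z → ⇑σ '' Z = Z → Z = ∅ ∨ Z = Set.univ)
    {U : Set X} (hU : IsClosed U) (hne : U.Nonempty) (hmaps : Set.MapsTo σ U U) :
    U = Set.univ := by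
  have hclosed : ∀ i : ℕ, IsClosed ((⇑σ)^[i] '' U) := fun i =>
    (hU.isCompact.image (σ.continuous.iterate i)).isClosed
  have hanti : ∀ i : ℕ, (⇑σ)^[i + 1] '' U ⊆ (⇑σ)^[i] '' U := by
    rintro i _ ⟨x, hx, rfl⟩
    exact ⟨σ x, hmaps hx, rfl⟩
  have hinv : ⇑σ '' (⋂ i : ℕ, (⇑σ)^[i] '' U) = ⋂ i : ℕ, (⇑σ)^[i] '' U := by
    have himage : ∀ i : ℕ, ⇑σ '' ((⇑σ)^[i] '' U) = (⇑σ)^[i + 1] '' U := fun i => by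
      rw [Function.iterate_succ', Set.image_comp]
    rw [Set.image_iInter σ.bijective]
    simp only [himage]
    refine Set.Subset.antisymm (Set.iInter_mono hanti) (Set.subset_iInter fun i => ?_)
    exact Set.iInter_subset _ (i + 1)
  have hnonempty : (⋂ i : ℕ, (⇑σ)^[i] '' U).Nonempty :=
    IsCompact.nonempty_iInter_of_sequence_nonempty_isCompact_isClosed _ hanti
      (fun i => hne.image _) (hclosed 0).isCompact hclosed
  have huniv := (hmin _ (isClosed_iInter hclosed) hinv).resolve_left hnonempty.ne_empty
  rw [← Set.univ_subset_iff, ← huniv]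
  simpa using Set.iInter_subset (fun i : ℕ => (⇑σ)^[i] '' U) 0

/-- The first return time is unique. -/
theorem firstReturnTimeIs.unique {X : Type*} {σ : X → X} {Y : Set X} {x : X} {m n : ℕ}
    (hm : firstReturnTimeIs σ Y x m) (hn : firstReturnTimeIs σ Y x n) : m = n := by
  rcases lt_trichotomy m n with h | h | h
  · exact absurd hm.2.1 (hn.2.2 m hm.1 h)
  · exact h
  · exact absurd hn.2.1 (hm.2.2 n hn.1 h)

/-- The points of a clopen set with a given first return time form a closed set. -/
theorem isClosed_setOf_firstReturnTimeIs {X : Type*} [TopologicalSpace X] {σ : X → X}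
    (hσ : Continuous σ) {Y : Set X} (hY : IsClopen Y) (n : ℕ) :
    IsClosed {x ∈ Y | firstReturnTimeIs σ Y x n} := by
  simp only [firstReturnTimeIs, Set.ofPred_and, Set.ofPred_forall]
  refine hY.isClosed.inter (isClosed_const.inter
    ((hY.isClosed.preimage (hσ.iterate n)).inter ?_))
  exact isClosed_iInter fun m => isClosed_iInter fun _ => isClosed_iInter fun _ =>
    hY.compl.isClosed.preimage (hσ.iterate m)

/-- If two points of `Y` reach the same point after `i ≤ j` steps of an injective map, and `j`
is at most the first return time of the second one, then the points and the times agree. -/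
theorem firstReturnTimeIs.eq_of_iterate_eq {X : Type*} {σ : X → X} (hσ : Function.Injective σ)
    {Y : Set X} {x y : X} {i j n : ℕ} (hx : x ∈ Y) (hy : firstReturnTimeIs σ Y y n)
    (hi : 1 ≤ i) (hij : i ≤ j) (hj : j ≤ n) (h : σ^[i] x = σ^[j] y) : i = j ∧ x = y := by
  obtain ⟨d, rfl⟩ := Nat.exists_eq_add_of_le hij
  rw [Function.iterate_add_apply] at h
  have hxy : x = σ^[d] y := hσ.iterate i h
  rcases Nat.eq_zero_or_pos d with rfl | hd
  · exact ⟨rfl, hxy⟩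
  · exact absurd (hxy ▸ hx) (hy.2.2 d hd (by omega))

/-- With `n 0 < n 1 < ... < n l` the distinct values of the first return
time `λ_Y` on `Y` and `Y_k = {x ∈ Y : λ_Y(x) = n k}`, the sets `σ^j(Y_k)` for
`0 ≤ k ≤ l`, `1 ≤ j ≤ n k` are pairwise disjoint and their union is `X`. -/
theorem rokhlin_tower_partition_of_X
    (X : Type*) [MetricSpace X] [CompactSpace X] (σ : X ≃ₜ X)
    (hmin : ∀ Z : Set X, IsClosed Z → ⇑σ '' Z = Z → Z = ∅ ∨ Z = Set.univ)
    (Y : Set X) (hY : IsClopen Y) (hYne : Y.Nonempty)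
    (l : ℕ) (n : Fin (l + 1) → ℕ) (hmono : StrictMono n)
    (hvals : ∀ x ∈ Y, ∃ k : Fin (l + 1), firstReturnTimeIs (⇑σ) Y x (n k))
    (hattained : ∀ k : Fin (l + 1), ∃ x ∈ Y, firstReturnTimeIs (⇑σ) Y x (n k)) :
    (∀ (k k' : Fin (l + 1)) (j j' : ℕ), 1 ≤ j → j ≤ n k → 1 ≤ j' → j' ≤ n k' →
      (k ≠ k' ∨ j ≠ j') →
      Disjoint ((⇑σ)^[j] '' {x ∈ Y | firstReturnTimeIs (⇑σ) Y x (n k)})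
               ((⇑σ)^[j'] '' {x ∈ Y | firstReturnTimeIs (⇑σ) Y x (n k')})) ∧
    (⋃ (k : Fin (l + 1)) (j ∈ Set.Icc 1 (n k)),
      (⇑σ)^[j] '' {x ∈ Y | firstReturnTimeIs (⇑σ) Y x (n k)}) = Set.univ := by
  constructor
  · intro k k' j j' hj hjk hj' hjk' hne
    rw [Set.disjoint_left]
    rintro _ ⟨x, ⟨hxY, hx⟩, rfl⟩ ⟨y, ⟨hyY, hy⟩, hxy⟩
    have heq : j = j' ∧ x = y := by
      rcases le_total j j' with h | h
      · exact hy.eq_of_iterate_eq σ.injective hxY hj h hjk' hxy.symm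
      · exact (hx.eq_of_iterate_eq σ.injective hyY hj' h hjk hxy).imp Eq.symm Eq.symm
    obtain ⟨rfl, rfl⟩ := heq
    exact hne.elim (fun h => h (hmono.injective (hx.unique hy))) (fun h => h rfl)
  · have hmem : ∀ {x : X} {k : Fin (l + 1)} {j : ℕ}, x ∈ Y → firstReturnTimeIs (⇑σ) Y x (n k) →
        1 ≤ j → j ≤ n k → (⇑σ)^[j] x ∈ ⋃ (k : Fin (l + 1)) (j ∈ Set.Icc 1 (n k)),
          (⇑σ)^[j] '' {x ∈ Y | firstReturnTimeIs (⇑σ) Y x (n k)} := by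
      intro x k j hxY hx hj hjk
      exact Set.mem_iUnion.2 ⟨k, Set.mem_iUnion₂.2 ⟨j, ⟨hj, hjk⟩, x, ⟨hxY, hx⟩, rfl⟩⟩
    apply eq_univ_of_mapsTo_of_minimal σ hmin
    · refine isClosed_iUnion_of_finite fun k => (Set.finite_Icc 1 (n k)).isClosed_biUnion
        fun j _ => IsCompact.isClosed ?_
      exact (isClosed_setOf_firstReturnTimeIs σ.continuous hY (n k)).isCompact.image
        (σ.continuous.iterate j)
    · obtain ⟨x, hxY⟩ := hYne
      obtain ⟨k, hx⟩ := hvals x hxY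
      exact ⟨_, hmem hxY hx le_rfl hx.1⟩
    · intro z hz
      obtain ⟨k, hz⟩ := Set.mem_iUnion.1 hz
      obtain ⟨j, ⟨hj, hjk⟩, x, ⟨hxY, hx⟩, rfl⟩ := Set.mem_iUnion₂.1 hz
      rcases hjk.lt_or_eq with h | rfl
      · rw [← Function.iterate_succ_apply' (⇑σ)]
        exact hmem hxY hx (by omega) h
      · obtain ⟨k', hy⟩ := hvals _ hx.2.1
        exact hmem hx.2.1 hy le_rfl hy.1
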